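/- Let q be a locally integrable complex function on ℝ and λ ∈ ℂ. Then for any y_0, y_1 ∈ ℂ, the function y = y_0 C_{q−λ,1} + y_1 S_{1,q−λ} is locally absolutely continuous with locally absolutely continuous derivative, satisfies y(0) = y_0, y′(0) = y_1, and solves the Schrödinger equation −y″ + q y = λ y almost everywhere. -/

import Mathlib

open MeasureTheory intervalIntegral Filter

noncomputable section

/-- Alternating product f(s1)g(s2)f(s3)⋯ with j factors (index 0 ↦ f). -/
def altProd (f g : ℝ → ℂ) (j : ℕ) (s : Fin j → ℝ) : ℂ :=
  ∏ i : Fin j, if (i : ℕ) % 2 = 0 then f (s i) else g (s i)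

/-- The signed simplex integral A_j(f,g,x). -/
def simplexA (f g : ℝ → ℂ) (j : ℕ) (x : ℝ) : ℂ :=
  if 0 ≤ x then
    ∫ s in {s : Fin j → ℝ | StrictMono s ∧ ∀ i, s i ∈ Set.Ioo 0 x}, altProd f g j s
  else
    (-1 : ℂ) ^ j *
      ∫ s in {s : Fin j → ℝ | StrictAnti s ∧ ∀ i, s i ∈ Set.Ioo x 0}, altProd f g j s

/-- The bivariate exponential E_{f,g}. -/
def bivE (f g : ℝ → ℂ) (x : ℝ) : ℂ := 1 + ∑' j : ℕ, simplexA f g (j + 1) x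

def bivC (f g : ℝ → ℂ) (x : ℝ) : ℂ := (bivE f g x + bivE (-f) (-g) x) / 2

def bivS (f g : ℝ → ℂ) (x : ℝ) : ℂ := (bivE f g x - bivE (-f) (-g) x) / 2

/-- Locally absolutely continuous complex-valued function on ℝ. -/
def LocAC (F : ℝ → ℂ) : Prop :=
  ∃ F' : ℝ → ℂ, LocallyIntegrable F' volume ∧
    ∀ x : ℝ, F x = F 0 + ∫ t in (0:ℝ)..x, F' t

/-- The iterated integrals `∫₀ˣ hⱼ(sⱼ) ∫₀^{sⱼ} ⋯ ∫₀^{s₂} h₁(s₁)`, where the `hᵢ` alternate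
between `f` and `g`, starting with `h₁ = f`. -/
def iterInt (f g : ℝ → ℂ) : ℕ → ℝ → ℂ
  | 0, _ => 1
  | j + 1, x => ∫ t in (0:ℝ)..x, (if j % 2 = 0 then f t else g t) * iterInt f g j t

end

section

theorem HasSum.congr_term {u v : ℕ → ℂ} {a : ℂ} (hu : HasSum u a) (h : ∀ j, v j = u j) :
    HasSum v a :=
  funext h ▸ hu

theorem locallyIntegrable_ite {f g : ℝ → ℂ} (hf : LocallyIntegrable f volume)
    (hg : LocallyIntegrable g volume) (j : ℕ) :
    LocallyIntegrable (fun t => if j % 2 = 0 then f t else g t) volume := by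
  split_ifs <;> assumption

theorem MeasureTheory.LocallyIntegrable.mul_continuous_complex {f F : ℝ → ℂ}
    (hf : LocallyIntegrable f volume)
    (hF : Continuous F) : LocallyIntegrable (fun t => f t * F t) volume := by
  rw [locallyIntegrable_iff]
  intro k hk
  exact (hf.integrableOn_isCompact hk).mul_continuousOn hF.continuousOn hk

theorem MeasureTheory.LocallyIntegrable.intervalIntegrable_real {E : Type*} [NormedAddCommGroup E]
    {f : ℝ → E} (hf : LocallyIntegrable f volume) (a b : ℝ) : IntervalIntegrable f volume a b :=
  intervalIntegrable_iff.mpr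
    ((hf.integrableOn_isCompact isCompact_uIcc).mono_set Set.uIoc_subset_uIcc)

theorem continuous_iterInt {f g : ℝ → ℂ} (hf : LocallyIntegrable f volume)
    (hg : LocallyIntegrable g volume) (j : ℕ) : Continuous (iterInt f g j) := by
  induction j with
  | zero => exact continuous_const
  | succ j ih =>
    exact intervalIntegral.continuous_primitive
      (fun a b =>
        ((locallyIntegrable_ite hf hg j).mul_continuous_complex ih).intervalIntegrable_real a b) 0

theorem integral_mul_primitive_pow {φ : ℝ → ℝ} (hφ : LocallyIntegrable φ volume) (n : ℕ) (x : ℝ) :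
    ∫ t in (0:ℝ)..x, φ t * (∫ s in (0:ℝ)..t, φ s) ^ n =
      (∫ s in (0:ℝ)..x, φ s) ^ (n + 1) / (n + 1) := by
  set F : ℝ → ℝ := fun t => ∫ s in (0:ℝ)..t, φ s with hF
  have hac : AbsolutelyContinuousOnInterval F 0 x :=
    (hφ.intervalIntegrable_real 0 x).absolutelyContinuousOnInterval_intervalIntegral
      (by simp)
  have hpow : ∀ m : ℕ, AbsolutelyContinuousOnInterval (fun t => F t ^ (m + 1)) 0 x := by
    intro m
    induction m with
    | zero => simpa using hac
    | succ m ih => simpa only [pow_succ _ (m + 1)] using ih.fun_mul hac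
  have h1 := (hpow n).integral_deriv_eq_sub
  have h2 : ∫ t in (0:ℝ)..x, deriv (fun t => F t ^ (n + 1)) t =
      ∫ t in (0:ℝ)..x, ((n : ℝ) + 1) * (φ t * F t ^ n) := by
    apply intervalIntegral.integral_congr_ae
    filter_upwards [LocallyIntegrable.ae_hasDerivAt_integral hφ] with t ht _
    have := ((ht 0).fun_pow (n + 1)).deriv
    rw [this]
    push_cast
    simp only [hF]
    ring
  rw [h2, intervalIntegral.integral_const_mul] at h1
  have hF0 : F 0 = 0 := by simp [hF]
  rw [hF0] at h1
  have hn : (n : ℝ) + 1 ≠ 0 := by positivity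
  rw [eq_div_iff hn, mul_comm, h1, zero_pow (Nat.succ_ne_zero n), sub_zero]

theorem abs_integral_mul_abs_primitive_pow {φ : ℝ → ℝ} (hφ : LocallyIntegrable φ volume)
    (h0 : ∀ t, 0 ≤ φ t) (n : ℕ) (x : ℝ) :
    |∫ t in (0:ℝ)..x, φ t * |∫ s in (0:ℝ)..t, φ s| ^ n| =
      |∫ s in (0:ℝ)..x, φ s| ^ (n + 1) / (n + 1) := by
  have key : |∫ t in (0:ℝ)..x, φ t * |∫ s in (0:ℝ)..t, φ s| ^ n| =
      |∫ t in (0:ℝ)..x, φ t * (∫ s in (0:ℝ)..t, φ s) ^ n| := by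
    rcases le_total 0 x with hx | hx
    · congr 1
      refine intervalIntegral.integral_congr fun t ht => ?_
      rw [Set.uIcc_of_le hx] at ht
      rw [abs_of_nonneg (intervalIntegral.integral_nonneg ht.1 fun u _ => h0 u)]
    · have : ∫ t in (0:ℝ)..x, φ t * |∫ s in (0:ℝ)..t, φ s| ^ n =
          ∫ t in (0:ℝ)..x, (-1) ^ n * (φ t * (∫ s in (0:ℝ)..t, φ s) ^ n) := by
        refine intervalIntegral.integral_congr fun t ht => ?_
        rw [Set.uIcc_of_ge hx] at ht
        have : ∫ s in (0:ℝ)..t, φ s ≤ 0 := by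
          rw [intervalIntegral.integral_symm]
          exact neg_nonpos.mpr (intervalIntegral.integral_nonneg ht.2 fun u _ => h0 u)
        rw [abs_of_nonpos this, neg_pow]
        ring
      rw [this, intervalIntegral.integral_const_mul, abs_mul]
      simp
  rw [key, integral_mul_primitive_pow hφ, abs_div, abs_pow]
  congr 1
  exact abs_of_nonneg (by positivity)

theorem norm_ite_le (f g : ℝ → ℂ) (j : ℕ) (t : ℝ) :
    ‖if j % 2 = 0 then f t else g t‖ ≤ ‖f t‖ + ‖g t‖ := by
  split_ifs <;> simp

theorem locallyIntegrable_norm_add_norm {f g : ℝ → ℂ} (hf : LocallyIntegrable f volume)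
    (hg : LocallyIntegrable g volume) :
    LocallyIntegrable (fun t => ‖f t‖ + ‖g t‖) volume :=
  fun x => (hf x).norm.add (hg x).norm

theorem norm_iterInt_le {f g : ℝ → ℂ} (hf : LocallyIntegrable f volume)
    (hg : LocallyIntegrable g volume) (j : ℕ) (x : ℝ) :
    ‖iterInt f g j x‖ ≤ |∫ s in (0:ℝ)..x, (‖f s‖ + ‖g s‖)| ^ j / j.factorial := by
  induction j generalizing x with
  | zero => simp [iterInt]
  | succ j ih =>
    set φ : ℝ → ℝ := fun s => ‖f s‖ + ‖g s‖ with hφdef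
    have hφ : LocallyIntegrable φ volume := locallyIntegrable_norm_add_norm hf hg
    have hcont : Continuous fun t => |∫ s in (0:ℝ)..t, φ s| ^ j :=
      (intervalIntegral.continuous_primitive (fun a b => hφ.intervalIntegrable_real a b) 0).abs.pow j
    have hle : ‖iterInt f g (j + 1) x‖ ≤
        |∫ t in (0:ℝ)..x, φ t * |∫ s in (0:ℝ)..t, φ s| ^ j / j.factorial| := by
      rw [iterInt]
      refine intervalIntegral.norm_integral_le_abs_of_norm_le (ae_of_all _ fun t => ?_)
        (((hφ.intervalIntegrable_real 0 x).mul_continuousOn hcont.continuousOn).div_const _)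
      rw [norm_mul, mul_div_assoc]
      exact mul_le_mul (norm_ite_le f g j t) (ih t) (norm_nonneg _) (by positivity)
    refine hle.trans_eq ?_
    rw [intervalIntegral.integral_div, abs_div,
      abs_integral_mul_abs_primitive_pow hφ fun t => by positivity]
    rw [abs_of_nonneg (by positivity : (0:ℝ) ≤ j.factorial), Nat.factorial_succ]
    push_cast
    field_simp

theorem exists_norm_iterInt_le {f g : ℝ → ℂ} (hf : LocallyIntegrable f volume)
    (hg : LocallyIntegrable g volume) {K : Set ℝ} (hK : IsCompact K) :
    ∃ B : ℝ, ∀ x ∈ K, ∀ j, ‖iterInt f g j x‖ ≤ B ^ j / j.factorial := by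
  have hφ : LocallyIntegrable (fun s => ‖f s‖ + ‖g s‖) volume :=
    locallyIntegrable_norm_add_norm hf hg
  have hc := intervalIntegral.continuous_primitive (fun a b => hφ.intervalIntegrable_real a b) 0
  obtain ⟨B, hB⟩ := hK.exists_bound_of_continuousOn hc.continuousOn
  refine ⟨B, fun x hx j => (norm_iterInt_le hf hg j x).trans ?_⟩
  gcongr
  exact hB x hx

theorem summable_iterInt {f g : ℝ → ℂ} (hf : LocallyIntegrable f volume)
    (hg : LocallyIntegrable g volume) (x : ℝ) : Summable fun j => iterInt f g j x :=
  (Real.summable_pow_div_factorial _).of_norm_bounded fun j => norm_iterInt_le hf hg j x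

theorem continuous_of_hasSum_iterInt {f g : ℝ → ℂ} (hf : LocallyIntegrable f volume)
    (hg : LocallyIntegrable g volume) {c : ℕ → ℂ} (hc : ∀ j, ‖c j‖ ≤ 1) {G : ℝ → ℂ}
    (hG : ∀ t, HasSum (fun j => c j * iterInt f g j t) (G t)) : Continuous G := by
  have hG' : G = fun t => ∑' j, c j * iterInt f g j t := funext fun t => (hG t).tsum_eq.symm
  rw [continuous_iff_continuousAt]
  intro x
  obtain ⟨B, hB⟩ := exists_norm_iterInt_le hf hg
    (isCompact_Icc : IsCompact (Set.Icc (x - 1) (x + 1)))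
  refine ContinuousOn.continuousAt (s := Set.Icc (x - 1) (x + 1)) ?_
    (Icc_mem_nhds (by linarith) (by linarith))
  rw [hG']
  refine continuousOn_tsum
    (fun j => (continuous_const.mul (continuous_iterInt hf hg j)).continuousOn)
    (Real.summable_pow_div_factorial B) fun j t ht => ?_
  rw [norm_mul]
  exact (mul_le_of_le_one_left (norm_nonneg _) (hc j)).trans (hB t ht j)

theorem hasSum_iterInt_succ {f g : ℝ → ℂ} (hf : LocallyIntegrable f volume)
    (hg : LocallyIntegrable g volume) {c : ℕ → ℂ} (hc : ∀ j, ‖c j‖ ≤ 1) {H : ℝ → ℂ}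
    (hH : ∀ t, HasSum (fun j => c j * ((if j % 2 = 0 then f t else g t) * iterInt f g j t)) (H t))
    (x : ℝ) : HasSum (fun j => c j * iterInt f g (j + 1) x) (∫ t in (0:ℝ)..x, H t) := by
  have hφ : LocallyIntegrable (fun s => ‖f s‖ + ‖g s‖) volume :=
    locallyIntegrable_norm_add_norm hf hg
  obtain ⟨B, hB⟩ := exists_norm_iterInt_le hf hg (isCompact_uIcc : IsCompact (Set.uIcc 0 x))
  have hs := Real.summable_pow_div_factorial B
  have hint : ∀ j, LocallyIntegrable
      (fun t => (if j % 2 = 0 then f t else g t) * iterInt f g j t) volume :=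
    fun j => (locallyIntegrable_ite hf hg j).mul_continuous_complex (continuous_iterInt hf hg j)
  simp only [iterInt, ← intervalIntegral.integral_const_mul]
  refine intervalIntegral.hasSum_integral_of_dominated_convergence
    (fun j t => (‖f t‖ + ‖g t‖) * (B ^ j / j.factorial)) (fun j => ?_)
    (fun j => ae_of_all _ fun t ht => ?_) (ae_of_all _ fun t _ => hs.mul_left _) ?_
    (ae_of_all _ fun t _ => hH t)
  · exact ((hint j).aestronglyMeasurable.const_mul (c j)).restrict
  · rw [norm_mul, norm_mul]
    refine (mul_le_of_le_one_left (by positivity) (hc j)).trans ?_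
    exact mul_le_mul (norm_ite_le f g j t) (hB t (Set.uIoc_subset_uIcc ht) j) (norm_nonneg _)
      (by positivity)
  · simp only [tsum_mul_left]
    exact (hφ.intervalIntegrable_real 0 x).mul_const _

theorem iterInt_neg (f g : ℝ → ℂ) (j : ℕ) (x : ℝ) :
    iterInt (-f) (-g) j x = (-1) ^ j * iterInt f g j x := by
  induction j generalizing x with
  | zero => simp [iterInt]
  | succ j ih =>
    simp only [iterInt, ← intervalIntegral.integral_const_mul]
    refine intervalIntegral.integral_congr fun t _ => ?_
    simp only [ih, Pi.neg_apply]
    split_ifs <;> ring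

theorem iterInt_comp_neg (f g : ℝ → ℂ) (j : ℕ) (x : ℝ) :
    iterInt (fun t => f (-t)) (fun t => g (-t)) j x = (-1) ^ j * iterInt f g j (-x) := by
  induction j generalizing x with
  | zero => simp [iterInt]
  | succ j ih =>
    simp only [iterInt, ih]
    have := intervalIntegral.integral_comp_neg (a := 0) (b := x)
      (fun t => (-1) ^ j * ((if j % 2 = 0 then f t else g t) * iterInt f g j t))
    rw [neg_zero, intervalIntegral.integral_symm 0 (-x), intervalIntegral.integral_const_mul _
      (fun t => (if j % 2 = 0 then f t else g t) * iterInt f g j t)] at this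
    rw [pow_succ, mul_neg_one, neg_mul, ← this]
    refine intervalIntegral.integral_congr fun t _ => ?_
    ring

/-- The open simplex `0 < s₁ < ⋯ < sⱼ < x`. -/
def openSimplex (j : ℕ) (x : ℝ) : Set (Fin j → ℝ) :=
  {s | StrictMono s ∧ ∀ i, s i ∈ Set.Ioo 0 x}

theorem measurableSet_openSimplex (j : ℕ) (x : ℝ) : MeasurableSet (openSimplex j x) := by
  have : openSimplex j x = (⋂ (a : Fin j) (b : Fin j) (_ : a < b), {s | s a < s b}) ∩
      ⋂ i : Fin j, {s | s i ∈ Set.Ioo 0 x} := by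
    ext s
    simp [openSimplex, StrictMono]
  rw [this]
  refine MeasurableSet.inter ?_ ?_
  · exact MeasurableSet.iInter fun a => MeasurableSet.iInter fun b => MeasurableSet.iInter fun _ =>
      measurableSet_lt (measurable_pi_apply a) (measurable_pi_apply b)
  · exact MeasurableSet.iInter fun i => measurable_pi_apply i measurableSet_Ioo

theorem snoc_mem_openSimplex {j : ℕ} {x t : ℝ} {s : Fin j → ℝ} :
    (Fin.snoc s t : Fin (j + 1) → ℝ) ∈ openSimplex (j + 1) x ↔
      t ∈ Set.Ioo 0 x ∧ s ∈ openSimplex j t := by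
  constructor
  · rintro ⟨hm, hI⟩
    refine ⟨by simpa using hI (Fin.last j), fun a b hab => ?_, fun i => ⟨?_, ?_⟩⟩
    · simpa using hm (Fin.castSucc_lt_castSucc_iff.mpr hab)
    · simpa using (hI i.castSucc).1
    · simpa using hm (Fin.castSucc_lt_last i)
  · rintro ⟨ht, hm, hI⟩
    refine ⟨fun a b hab => ?_, fun i => ?_⟩
    · induction b using Fin.lastCases with
      | last =>
        induction a using Fin.lastCases with
        | last => exact absurd hab (lt_irrefl _)
        | cast a => simpa using (hI a).2
      | cast b =>
        induction a using Fin.lastCases with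
        | last => exact absurd hab (not_lt.mpr (Fin.le_last _))
        | cast a => simpa using hm (Fin.castSucc_lt_castSucc_iff.mp hab)
    · induction i using Fin.lastCases with
      | last => simpa using ht
      | cast i => simpa using ⟨(hI i).1, (hI i).2.trans ht.2⟩

theorem altProd_snoc (f g : ℝ → ℂ) (j : ℕ) (s : Fin j → ℝ) (t : ℝ) :
    altProd f g (j + 1) (Fin.snoc s t) = (if j % 2 = 0 then f t else g t) * altProd f g j s := by
  simp [altProd, Fin.prod_univ_castSucc, mul_comm]

theorem integrableOn_altProd {f g : ℝ → ℂ} (hf : LocallyIntegrable f volume)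
    (hg : LocallyIntegrable g volume) (j : ℕ) (x : ℝ) :
    IntegrableOn (altProd f g j) (openSimplex j x) := by
  have hbox : IntegrableOn (altProd f g j) (Set.univ.pi fun _ => Set.Icc 0 x) := by
    rw [IntegrableOn, volume_pi, Measure.restrict_pi_pi]
    exact Integrable.fintype_prod (f := fun (i : Fin j) t => if (i : ℕ) % 2 = 0 then f t else g t)
      fun i => (locallyIntegrable_ite hf hg i).integrableOn_isCompact isCompact_Icc
  exact hbox.mono_set fun s hs i _ => Set.Ioo_subset_Icc_self (hs.2 i)

theorem setIntegral_openSimplex {f g : ℝ → ℂ} (hf : LocallyIntegrable f volume)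
    (hg : LocallyIntegrable g volume) (j : ℕ) {x : ℝ} (hx : 0 ≤ x) :
    ∫ s in openSimplex j x, altProd f g j s = iterInt f g j x := by
  induction j generalizing x with
  | zero =>
    have : openSimplex 0 x = Set.univ :=
      Set.eq_univ_of_forall fun s => ⟨fun a => a.elim0, fun i => i.elim0⟩
    simp [this, altProd, iterInt, volume_pi, measureReal_def]
  | succ j ih =>
    set e := (MeasurableEquiv.piFinSuccAbove (fun _ : Fin (j + 1) => ℝ) (Fin.last j)).symm
    have he : MeasurePreserving e :=
      (volume_preserving_piFinSuccAbove (fun _ : Fin (j + 1) => ℝ) (Fin.last j)).symm _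
    have hsnoc : ∀ p : ℝ × (Fin j → ℝ), e p = Fin.snoc p.2 p.1 := fun p =>
      Fin.insertNth_last' p.1 p.2
    have hmem : ∀ t s, (t, s) ∈ e ⁻¹' openSimplex (j + 1) x ↔
        t ∈ Set.Ioo 0 x ∧ s ∈ openSimplex j t := fun t s => by
      rw [Set.mem_preimage, hsnoc, snoc_mem_openSimplex]
    have hmeas := e.measurable (measurableSet_openSimplex (j + 1) x)
    have hint : IntegrableOn (fun p => altProd f g (j + 1) (e p))
        (e ⁻¹' openSimplex (j + 1) x) :=
      (he.integrableOn_comp_preimage e.measurableEmbedding).mpr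
        (integrableOn_altProd hf hg (j + 1) x)
    rw [← he.setIntegral_preimage_emb e.measurableEmbedding,
      ← MeasureTheory.integral_indicator hmeas, Measure.volume_eq_prod,
      integral_prod _ ((integrable_indicator_iff hmeas).mpr hint), iterInt,
      intervalIntegral.integral_of_le hx, integral_Ioc_eq_integral_Ioo,
      ← MeasureTheory.integral_indicator measurableSet_Ioo]
    congr 1
    ext t
    by_cases ht : t ∈ Set.Ioo 0 x
    · rw [Set.indicator_of_mem ht, ← ih ht.1.le, ← MeasureTheory.integral_const_mul,
        ← MeasureTheory.integral_indicator (measurableSet_openSimplex j t)]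
      congr 1
      ext s
      by_cases hs : s ∈ openSimplex j t
      · rw [Set.indicator_of_mem ((hmem t s).mpr ⟨ht, hs⟩), Set.indicator_of_mem hs, hsnoc,
          altProd_snoc]
      · rw [Set.indicator_of_notMem (fun h => hs ((hmem t s).mp h).2), Set.indicator_of_notMem hs]
    · rw [Set.indicator_of_notMem ht]
      refine integral_eq_zero_of_ae (ae_of_all _ fun s => ?_)
      exact Set.indicator_of_notMem (fun h => ht ((hmem t s).mp h).1) _

theorem MeasureTheory.LocallyIntegrable.comp_neg_real {f : ℝ → ℂ}
    (hf : LocallyIntegrable f volume) :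
    LocallyIntegrable (fun t => f (-t)) volume := by
  rw [locallyIntegrable_iff]
  intro k hk
  have := (Measure.measurePreserving_neg (volume : Measure ℝ)).integrableOn_comp_preimage
    (MeasurableEquiv.neg ℝ).measurableEmbedding (f := f) (s := -k)
  have h2 := this.mpr (hf.integrableOn_isCompact hk.neg)
  simpa [Function.comp_def] using h2

theorem simplexA_eq_iterInt {f g : ℝ → ℂ} (hf : LocallyIntegrable f volume)
    (hg : LocallyIntegrable g volume) (j : ℕ) (x : ℝ) :
    simplexA f g j x = iterInt f g j x := by
  rw [simplexA]
  split_ifs with hx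
  · exact setIntegral_openSimplex hf hg j hx
  · have h := setIntegral_openSimplex hf.comp_neg_real hg.comp_neg_real j
      (x := -x) (by linarith)
    rw [iterInt_comp_neg, neg_neg] at h
    have hneg := (Measure.measurePreserving_neg
      (volume : Measure (Fin j → ℝ))).setIntegral_preimage_emb
      (MeasurableEquiv.neg (Fin j → ℝ)).measurableEmbedding (altProd f g j)
      {s : Fin j → ℝ | StrictAnti s ∧ ∀ i, s i ∈ Set.Ioo x 0}
    have hset : (Neg.neg ⁻¹' {s : Fin j → ℝ | StrictAnti s ∧ ∀ i, s i ∈ Set.Ioo x 0}) =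
        openSimplex j (-x) := by
      ext s
      simp only [openSimplex, Set.mem_preimage, Set.mem_ofPred_eq, Set.mem_Ioo, Pi.neg_apply,
        StrictAnti, StrictMono, neg_lt_neg_iff, Left.neg_neg_iff]
      refine and_congr Iff.rfl (forall_congr' fun i => ?_)
      rw [and_comm, lt_neg]
    have hfun : ∀ s : Fin j → ℝ, altProd f g j (-s) =
        altProd (fun t => f (-t)) (fun t => g (-t)) j s := fun s => rfl
    rw [← hneg, hset]
    simp only [hfun]
    rw [h, ← mul_assoc, ← mul_pow]
    simp

theorem hasSum_bivE {f g : ℝ → ℂ} (hf : LocallyIntegrable f volume)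
    (hg : LocallyIntegrable g volume) (x : ℝ) :
    HasSum (fun j => iterInt f g j x) (bivE f g x) := by
  have hs := summable_iterInt hf hg x
  have : bivE f g x = ∑' j, iterInt f g j x := by
    rw [hs.tsum_eq_zero_add, bivE]
    simp only [simplexA_eq_iterInt hf hg]
    rfl
  rw [this]
  exact hs.hasSum

theorem hasSum_bivE_neg {f g : ℝ → ℂ} (hf : LocallyIntegrable f volume)
    (hg : LocallyIntegrable g volume) (x : ℝ) :
    HasSum (fun j => (-1) ^ j * iterInt f g j x) (bivE (-f) (-g) x) := by
  simpa only [iterInt_neg] using hasSum_bivE hf.neg hg.neg x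

theorem hasSum_bivC {f g : ℝ → ℂ} (hf : LocallyIntegrable f volume)
    (hg : LocallyIntegrable g volume) (x : ℝ) :
    HasSum (fun j => (if j % 2 = 0 then 1 else 0) * iterInt f g j x) (bivC f g x) := by
  have := (((hasSum_bivE hf hg x).add (hasSum_bivE_neg hf hg x)).div_const 2)
  refine HasSum.congr_term this fun j => ?_
  split_ifs with h
  · rw [(Nat.even_iff.mpr h).neg_one_pow]; ring
  · rw [(Nat.odd_iff.mpr (by omega)).neg_one_pow]; ring

theorem hasSum_bivS {f g : ℝ → ℂ} (hf : LocallyIntegrable f volume)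
    (hg : LocallyIntegrable g volume) (x : ℝ) :
    HasSum (fun j => (if j % 2 = 0 then 0 else 1) * iterInt f g j x) (bivS f g x) := by
  have := (((hasSum_bivE hf hg x).sub (hasSum_bivE_neg hf hg x)).div_const 2)
  refine HasSum.congr_term this fun j => ?_
  split_ifs with h
  · rw [(Nat.even_iff.mpr h).neg_one_pow]; ring
  · rw [(Nat.odd_iff.mpr (by omega)).neg_one_pow]; ring

theorem continuous_bivC {f g : ℝ → ℂ} (hf : LocallyIntegrable f volume)
    (hg : LocallyIntegrable g volume) : Continuous (bivC f g) :=
  continuous_of_hasSum_iterInt hf hg (fun j => by split_ifs <;> simp) (hasSum_bivC hf hg)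

theorem continuous_bivS {f g : ℝ → ℂ} (hf : LocallyIntegrable f volume)
    (hg : LocallyIntegrable g volume) : Continuous (bivS f g) :=
  continuous_of_hasSum_iterInt hf hg (fun j => by split_ifs <;> simp) (hasSum_bivS hf hg)

theorem bivS_eq_integral {f g : ℝ → ℂ} (hf : LocallyIntegrable f volume)
    (hg : LocallyIntegrable g volume) (x : ℝ) :
    bivS f g x = ∫ t in (0:ℝ)..x, f t * bivC f g t := by
  have h := hasSum_iterInt_succ hf hg (c := fun j => if j % 2 = 0 then 1 else 0)
    (fun j => by split_ifs <;> simp) (H := fun t => f t * bivC f g t) (fun t => by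
      refine HasSum.congr_term ((hasSum_bivC hf hg t).mul_left (f t)) fun j => ?_
      split_ifs <;> simp) x
  refine HasSum.unique (hasSum_bivS hf hg x) ((hasSum_nat_add_iff' 1).mp ?_)
  have h0 : ∑ i ∈ Finset.range 1, (if i % 2 = 0 then 0 else 1) * iterInt f g i x = 0 := by
    simp
  rw [h0, sub_zero]
  refine HasSum.congr_term h fun j => ?_
  congr 1
  grind

theorem bivC_eq_integral {f g : ℝ → ℂ} (hf : LocallyIntegrable f volume)
    (hg : LocallyIntegrable g volume) (x : ℝ) :
    bivC f g x = 1 + ∫ t in (0:ℝ)..x, g t * bivS f g t := by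
  have h := hasSum_iterInt_succ hf hg (c := fun j => if j % 2 = 0 then 0 else 1)
    (fun j => by split_ifs <;> simp) (H := fun t => g t * bivS f g t) (fun t => by
      refine HasSum.congr_term ((hasSum_bivS hf hg t).mul_left (g t)) fun j => ?_
      split_ifs <;> simp) x
  refine HasSum.unique (hasSum_bivC hf hg x) ((hasSum_nat_add_iff' 1).mp ?_)
  have h0 : ∑ i ∈ Finset.range 1, (if i % 2 = 0 then 1 else 0) * iterInt f g i x = 1 := by
    simp [iterInt]
  rw [h0, add_sub_cancel_left]
  refine HasSum.congr_term h fun j => ?_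
  congr 1
  grind

end

theorem schroedinger_solution (q : ℝ → ℂ) (hq : LocallyIntegrable q volume)
    (lam : ℂ) (y₀ y₁ : ℂ) (f : ℝ → ℂ) (hfdef : f = fun x => q x - lam)
    (y y' : ℝ → ℂ)
    (hy : y = fun x => y₀ * bivC f (fun _ => 1) x + y₁ * bivS (fun _ => 1) f x)
    (hy' : y' = fun x => y₀ * bivS f (fun _ => 1) x + y₁ * bivC (fun _ => 1) f x) :
    LocAC y ∧ LocAC y' ∧
    (∀ᵐ x : ℝ, HasDerivAt y (y' x) x) ∧
    y 0 = y₀ ∧ y' 0 = y₁ ∧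
    (∀ᵐ x : ℝ, ∃ D : ℂ, HasDerivAt y' D x ∧ -D + q x * y x = lam * y x) := by
  have hf : LocallyIntegrable f volume := by
    rw [hfdef]
    exact hq.sub (locallyIntegrable_const lam)
  have h1 : LocallyIntegrable (fun _ : ℝ => (1 : ℂ)) volume := locallyIntegrable_const 1
  have hyc : Continuous y := by
    rw [hy]
    exact ((continuous_bivC hf h1).const_mul y₀).add ((continuous_bivS h1 hf).const_mul y₁)
  have hy'c : Continuous y' := by
    rw [hy']
    exact ((continuous_bivS hf h1).const_mul y₀).add ((continuous_bivC h1 hf).const_mul y₁)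
  have hfy : LocallyIntegrable (fun t => f t * y t) volume := hf.mul_continuous_complex hyc
  have hy'l : LocallyIntegrable y' volume := hy'c.locallyIntegrable
  have hyint : ∀ x, y x = y₀ + ∫ t in (0:ℝ)..x, y' t := fun x => by
    simp only [hy, hy']
    rw [intervalIntegral.integral_add
      (((continuous_bivS hf h1).const_mul y₀).intervalIntegrable _ _)
      (((continuous_bivC h1 hf).const_mul y₁).intervalIntegrable _ _),
      intervalIntegral.integral_const_mul, intervalIntegral.integral_const_mul,
      bivC_eq_integral hf h1, bivS_eq_integral h1 hf]
    simp only [one_mul]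
    ring
  have hy'int : ∀ x, y' x = y₁ + ∫ t in (0:ℝ)..x, f t * y t := fun x => by
    have hsplit : (fun t => f t * y t) = fun t =>
        y₀ * (f t * bivC f (fun _ => 1) t) + y₁ * (f t * bivS (fun _ => 1) f t) := by
      rw [hy]
      ext t
      ring
    rw [hsplit, intervalIntegral.integral_add
      (((hf.mul_continuous_complex
        (continuous_bivC hf h1)).intervalIntegrable_real 0 x).const_mul y₀)
      (((hf.mul_continuous_complex
        (continuous_bivS h1 hf)).intervalIntegrable_real 0 x).const_mul y₁),
      intervalIntegral.integral_const_mul, intervalIntegral.integral_const_mul]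
    simp only [hy']
    rw [bivS_eq_integral hf h1, bivC_eq_integral h1 hf]
    ring
  have hy0 : y 0 = y₀ := by simpa using hyint 0
  have hy'0 : y' 0 = y₁ := by simpa using hy'int 0
  refine ⟨⟨y', hy'l, fun x => by rw [hy0, ← hyint]⟩,
    ⟨fun t => f t * y t, hfy, fun x => by rw [hy'0, ← hy'int]⟩, ?_, hy0, hy'0, ?_⟩
  · filter_upwards [LocallyIntegrable.ae_hasDerivAt_integral hy'l] with x hx
    rw [funext hyint]
    exact (hx 0).const_add y₀
  · filter_upwards [LocallyIntegrable.ae_hasDerivAt_integral hfy] with x hx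
    refine ⟨f x * y x, ?_, ?_⟩
    · rw [funext hy'int]
      exact (hx 0).const_add y₁
    · rw [hfdef]
      ring
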